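/- Let $G$ be a group, let $x, y, w \in G$, and suppose $G$ is generated by the set $\{x, y\}$. Let $p$ be an integer and let $\varepsilon \in \{1, -1\}$. If $w x w^{-1} y^{\varepsilon} = 1$ and $y^{\varepsilon}(x y^{\varepsilon})^{p} = 1$, then $G$ is the trivial group, i.e., every element of $G$ equals the identity. -/

import Mathlib

/-- Group-theoretic content of the simple-connectivity of the pochette surgery
`S⁴(e, p/(p+1), ε)` along a ribbon 2-knot of 1-fusion: the group
`⟨x, y | w x w⁻¹ yᵉ, yᵉ (x yᵉ)ᵖ⟩` is trivial. -/
theorem pochette_one_fusion_group_trivial {G : Type*} [Group G] (x y w : G)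
    (hgen : Subgroup.closure ({x, y} : Set G) = ⊤) (p : ℤ) (ε : ℤ)
    (hε : ε = 1 ∨ ε = -1)
    (h1 : w * x * w⁻¹ * y ^ ε = 1)
    (h2 : y ^ ε * (x * y ^ ε) ^ p = 1) :
    ∀ g : G, g = 1 := by
  obtain ⟨z, hz⟩ : ∃ z, z = x * y ^ ε := ⟨_, rfl⟩
  rw [← hz] at h2
  have hyε : y ^ ε = z ^ (-p) := by rw [zpow_neg]; exact eq_inv_of_mul_eq_one_left h2
  have hx : x = z ^ (p + 1) := by
    rw [eq_mul_inv_of_mul_eq hz.symm, hyε, zpow_neg, inv_inv, zpow_add, zpow_one,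
      (Commute.refl z).zpow_right p]
  have hy : y = z ^ (-p * ε) := by
    rw [zpow_mul, ← hyε, ← zpow_mul]
    rcases hε with rfl | rfl <;> simp
  have hcyclic (g : G) : g ∈ Subgroup.zpowers z := by
    have hle : Subgroup.closure ({x, y} : Set G) ≤ Subgroup.zpowers z := by
      rw [Subgroup.closure_le]
      rintro _ (rfl | rfl)
      exacts [⟨_, hx.symm⟩, ⟨_, hy.symm⟩]
    exact hle (hgen ▸ Subgroup.mem_top g)
  obtain ⟨k, rfl⟩ := hcyclic w
  have hcomm : z ^ k * x = x * z ^ k := by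
    rw [hx]
    exact (Commute.refl z).zpow_zpow k (p + 1)
  have hz1 : z = 1 := by rwa [hcomm, mul_inv_cancel_right, ← hz] at h1
  intro g
  obtain ⟨m, rfl⟩ := hcyclic g
  simp [hz1]
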